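/- Let d ∈ N, 2 < p < ∞, define r by 1/r = 1/2 − 1/p, set α = s/d, and assume s > d(1/2 − 1/p) (equivalently αr > 1). Then for all n ≥ 9^d e^{d/2} one has a_{n+1}(I_d : H^{s,2}(T^d) → L_p(T^d)) ≤ (αr − 1)^{-1/r} · (32e/d)^{s/2} · n^{1/2 − 1/p − s/d}. -/

import Mathlib

open MeasureTheory Filter
open scoped ENNReal NNReal

noncomputable section

/-- The index lattice `ℤ^d`. -/
abbrev ZLat (d : ℕ) := Fin d → ℤ

instance fact_two_pi_pos : Fact (0 < 2 * Real.pi) := ⟨by positivity⟩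

/-- The `d`-dimensional torus `𝕋^d = [0,2π]^d` with endpoints identified. -/
abbrev Torus (d : ℕ) := Fin d → AddCircle (2 * Real.pi)

/-- The normalized Lebesgue measure `(2π)^{-d} dx` on the `d`-torus. -/
def torusMeasure (d : ℕ) : Measure (Torus d) :=
  ((ENNReal.ofReal (2 * Real.pi))⁻¹) ^ d • Measure.pi fun _ => volume

/-- The character `e^{i k·x}` on the `d`-torus. -/
def torusChar {d : ℕ} (k : ZLat d) (x : Torus d) : ℂ :=
  ∏ j, fourier (k j) (x j)

/-- The `k`-th Fourier coefficient `f̂(k) = (2π)^{-d} ∫_{𝕋^d} f(x) e^{-i k·x} dx`. -/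
def fourierCoef {d : ℕ} (f : Torus d → ℂ) (k : ZLat d) : ℂ :=
  ∫ x, (starRingEnd ℂ) (torusChar k x) * f x ∂(torusMeasure d)

/-- The `n`-th approximation number of a bounded linear operator `T`:
`a_n(T) = inf {‖T - A‖ : rank A < n}`. -/
def approxNum {X Y : Type*} [NormedAddCommGroup X] [NormedSpace ℂ X]
    [NormedAddCommGroup Y] [NormedSpace ℂ Y] (T : X →L[ℂ] Y) (n : ℕ) : ℝ :=
  sInf {c : ℝ | ∃ A : X →L[ℂ] Y,
    Module.rank ℂ (LinearMap.range (A : X →ₗ[ℂ] Y)) < n ∧ c = ‖T - A‖}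

/-- `ℓ²(ℤ^d)`; an isometric model of the Hilbert space `F_d(w)` via `f ↦ (w(k)·f̂(k))_k`.
Under this identification the embedding `I_d : F_d(w) → G` is characterized by the
property that the function `T c` has Fourier coefficients `c(k)/w(k)`. -/
abbrev ellTwo (d : ℕ) := lp (fun _ : ZLat d => ℂ) 2

/-- `ℓ¹(ℤ^d)`; an isometric model of the Wiener algebra `A(𝕋^d)` via `f ↦ (f̂(k))_k`. -/
abbrev ellOne (d : ℕ) := lp (fun _ : ZLat d => ℂ) 1

/-- `ℓ^∞(ℤ^d)`; an isometric model of the space `ℬ(𝕋^d)` of distributions with bounded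
Fourier coefficients. -/
abbrev ellInfty (d : ℕ) := lp (fun _ : ZLat d => ℂ) ⊤

/-- The weight `w_{s,r}(k) = (1 + ∑_j |k_j|^r)^{s/r}` of the isotropic Sobolev space
`H^{s,r}(𝕋^d) = F_d(w_{s,r})`. -/
def wIso (d : ℕ) (s r : ℝ) (k : ZLat d) : ℝ := (1 + ∑ j, |(k j : ℝ)| ^ r) ^ (s / r)

/-- Gaussian sums over symmetric integer intervals are controlled by the Gaussian integral. -/
lemma sum_Icc_exp_neg_sq_le {t : ℝ} (ht : 0 < t) (K : ℕ) :
    ∑ m ∈ Finset.Icc (-(K : ℤ)) K, Real.exp (-t * (m : ℝ) ^ 2) ≤ 1 + √(Real.pi / t) := by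
  have hhalf : ∑ i ∈ Finset.range K, Real.exp (-t * ((i + 1 : ℕ) : ℝ) ^ 2) ≤
      √(Real.pi / t) / 2 := by
    have hanti : AntitoneOn (fun x : ℝ => Real.exp (-t * x ^ 2)) (Set.Icc (0 : ℝ) (0 + (K : ℕ))) := by
      intro x hx y hy hxy
      apply Real.exp_le_exp.2
      have : x ^ 2 ≤ y ^ 2 := pow_le_pow_left₀ hx.1 hxy 2
      nlinarith
    have h1 := hanti.sum_le_integral
    have h2 : ∫ x in (0 : ℝ)..(0 + (K : ℕ)), Real.exp (-t * x ^ 2) ≤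
        ∫ x in Set.Ioi (0 : ℝ), Real.exp (-t * x ^ 2) := by
      rw [intervalIntegral.integral_of_le (by positivity)]
      apply setIntegral_mono_set (integrable_exp_neg_mul_sq ht).integrableOn
      · filter_upwards with x using (Real.exp_pos _).le
      · exact (Set.Ioc_subset_Ioi_self).eventuallyLE
    rw [integral_gaussian_Ioi] at h2
    refine le_trans (le_of_eq ?_) (h1.trans h2)
    simp
  have hsplit : ∀ L : ℕ, ∑ m ∈ Finset.Icc (-(L : ℤ)) L, Real.exp (-t * (m : ℝ) ^ 2) =
      1 + 2 * ∑ i ∈ Finset.range L, Real.exp (-t * ((i + 1 : ℕ) : ℝ) ^ 2) := by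
    intro L
    induction L with
    | zero => simp
    | succ L ih =>
      have h : Finset.Icc (-((L + 1 : ℕ) : ℤ)) ((L + 1 : ℕ) : ℤ) =
          insert (-((L + 1 : ℕ) : ℤ)) (insert ((L + 1 : ℕ) : ℤ) (Finset.Icc (-(L : ℤ)) L)) := by
        ext m
        simp only [Finset.mem_Icc, Finset.mem_insert]
        push_cast
        omega
      rw [h, Finset.sum_insert, Finset.sum_insert, ih, Finset.sum_range_succ]
      · push_cast
        rw [neg_sq]
        ring
      · simp
      · simp only [Finset.mem_Icc, Finset.mem_insert]
        push_cast
        omega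
  rw [hsplit]
  linarith

/-- A Gaussian bound for the number of lattice points in a ball. -/
lemma card_le_exp_mul_pow {d : ℕ} (A : Finset (ZLat d)) {t Q : ℝ} (ht : 0 < t)
    (hA : ∀ k ∈ A, ∑ j, (k j : ℝ) ^ 2 ≤ Q) :
    (A.card : ℝ) ≤ Real.exp (t * Q) * (1 + √(Real.pi / t)) ^ d := by
  classical
  obtain ⟨K, hK⟩ : ∃ K : ℕ, A ⊆ Fintype.piFinset fun _ : Fin d => Finset.Icc (-(K : ℤ)) K := by
    refine ⟨A.sup fun k => Finset.univ.sup fun j => (k j).natAbs, fun k hk => ?_⟩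
    rw [Fintype.mem_piFinset]
    intro j
    have h1 : (k j).natAbs ≤ Finset.univ.sup fun j => (k j).natAbs :=
      Finset.le_sup (f := fun j => (k j).natAbs) (Finset.mem_univ j)
    have h2 := Finset.le_sup (f := fun k : ZLat d => Finset.univ.sup fun j => (k j).natAbs) hk
    have h3 := h1.trans h2
    rw [Finset.mem_Icc]
    omega
  calc (A.card : ℝ) = ∑ k ∈ A, 1 := by simp
    _ ≤ ∑ k ∈ A, Real.exp (t * Q) * ∏ j, Real.exp (-t * (k j : ℝ) ^ 2) := by
      apply Finset.sum_le_sum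
      intro k hk
      rw [← Real.exp_sum, ← Real.exp_add, ← Finset.mul_sum]
      apply Real.one_le_exp
      nlinarith [hA k hk]
    _ ≤ ∑ k ∈ Fintype.piFinset fun _ : Fin d => Finset.Icc (-(K : ℤ)) K,
          Real.exp (t * Q) * ∏ j, Real.exp (-t * (k j : ℝ) ^ 2) :=
      Finset.sum_le_sum_of_subset_of_nonneg hK fun k _ _ => by positivity
    _ = Real.exp (t * Q) *
          (∑ m ∈ Finset.Icc (-(K : ℤ)) K, Real.exp (-t * (m : ℝ) ^ 2)) ^ d := by
      rw [← Finset.mul_sum, ← Finset.prod_univ_sum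
        (fun _ : Fin d => Finset.Icc (-(K : ℤ)) K) (fun _ m => Real.exp (-t * (m : ℝ) ^ 2))]
      simp
    _ ≤ _ := by
      gcongr
      exact sum_Icc_exp_neg_sq_le ht K

/-- A large set of lattice points in a ball has at most `(32 e Q / d)^{d/2}` elements. -/
lemma card_le_of_large {d : ℕ} (hd : 0 < d) (A : Finset (ZLat d)) {Q : ℝ}
    (hA : ∀ k ∈ A, 1 + ∑ j, (k j : ℝ) ^ 2 ≤ Q)
    (hlarge : (9 : ℝ) ^ d * Real.exp ((d : ℝ) / 2) ≤ A.card) :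
    (A.card : ℝ) ≤ (32 * Real.exp 1 / d * Q) ^ ((d : ℝ) / 2) := by
  have hd' : (0 : ℝ) < d := by exact_mod_cast hd
  have hQ : 0 < Q := by
    have hpos : (0 : ℝ) < A.card := lt_of_lt_of_le (by positivity) hlarge
    obtain ⟨k, hk⟩ := Finset.card_pos.1 (by exact_mod_cast hpos : 0 < A.card)
    have := hA k hk
    have h2 : 0 ≤ ∑ j, (k j : ℝ) ^ 2 := Finset.sum_nonneg fun j _ => sq_nonneg _
    linarith
  set y : ℝ := √(2 * Q / d) with hy
  have hy0 : 0 ≤ y := Real.sqrt_nonneg _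
  have hy2 : y ^ 2 = 2 * Q / d := Real.sq_sqrt (by positivity)
  have hcard : (A.card : ℝ) ≤ Real.exp ((d : ℝ) / 2) * (1 + √Real.pi * y) ^ d := by
    have h := card_le_exp_mul_pow A (t := d / (2 * Q)) (Q := Q) (by positivity)
      (fun k hk => by linarith [hA k hk])
    have h1 : (d : ℝ) / (2 * Q) * Q = d / 2 := by field_simp
    have h2 : √(Real.pi / (d / (2 * Q))) = √Real.pi * y := by
      rw [hy, ← Real.sqrt_mul Real.pi_pos.le]
      congr 1
      field_simp
    rwa [h1, h2] at h
  have hpi : √Real.pi ≤ 2 := by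
    rw [Real.sqrt_le_left (by norm_num)]
    linarith [Real.pi_le_four]
  have hpow : (9 : ℝ) ^ d ≤ (1 + √Real.pi * y) ^ d := by
    have h := hlarge.trans hcard
    rw [mul_comm] at h
    exact le_of_mul_le_mul_left h (Real.exp_pos _)
  have hbase : (9 : ℝ) ≤ 1 + √Real.pi * y :=
    le_of_pow_le_pow_left₀ hd.ne' (by positivity) hpow
  have hy4 : 1 + √Real.pi * y ≤ 4 * y := by nlinarith
  calc (A.card : ℝ) ≤ Real.exp ((d : ℝ) / 2) * (4 * y) ^ d := by
        refine hcard.trans ?_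
        gcongr
    _ = (32 * Real.exp 1 / d * Q) ^ ((d : ℝ) / 2) := by
      have h3 : 32 * Real.exp 1 / d * Q = Real.exp 1 * (4 * y) ^ 2 := by
        rw [mul_pow, hy2]
        ring
      rw [h3, Real.mul_rpow (Real.exp_pos _).le (by positivity), ← Real.exp_mul, one_mul,
        ← Real.rpow_natCast (4 * y) 2, ← Real.rpow_mul (by positivity),
        ← Real.rpow_natCast (4 * y) d]
      congr 2
      push_cast
      ring

/-- Partial sums of `(n + i)^{-β}` are controlled by the corresponding integral. -/
lemma sum_range_rpow_neg_le {n : ℕ} (hn : 0 < n) {β : ℝ} (hβ : 1 < β) (m : ℕ) :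
    ∑ i ∈ Finset.range m, ((n : ℝ) + (i + 1 : ℕ)) ^ (-β) ≤ (n : ℝ) ^ (1 - β) / (β - 1) := by
  have hn' : (0 : ℝ) < n := by exact_mod_cast hn
  have hstep : ∀ x : ℝ, 0 < x →
      (x + 1) ^ (-β) ≤ (x ^ (1 - β) - (x + 1) ^ (1 - β)) / (β - 1) := by
    intro x hx
    have hx1 : 0 < x + 1 := by linarith
    have hlog : 1 / (x + 1) ≤ Real.log (x + 1) - Real.log x := by
      have h := Real.log_le_sub_one_of_pos (div_pos hx hx1)
      rw [Real.log_div hx.ne' hx1.ne'] at h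
      have : x / (x + 1) - 1 = -(1 / (x + 1)) := by field_simp; ring
      linarith
    have hratio : 1 + (β - 1) / (x + 1) ≤ x ^ (1 - β) / (x + 1) ^ (1 - β) := by
      rw [Real.rpow_def_of_pos hx, Real.rpow_def_of_pos hx1, ← Real.exp_sub]
      have h1 := Real.add_one_le_exp (Real.log x * (1 - β) - Real.log (x + 1) * (1 - β))
      have h2 : (β - 1) * (1 / (x + 1)) ≤ (β - 1) * (Real.log (x + 1) - Real.log x) :=
        mul_le_mul_of_nonneg_left hlog (by linarith)
      rw [mul_one_div] at h2
      linarith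
    have hpos : 0 < (x + 1) ^ (1 - β) := Real.rpow_pos_of_pos hx1 _
    rw [le_div_iff₀ hpos] at hratio
    rw [le_div_iff₀ (by linarith)]
    have h3 : (x + 1) ^ (-β) = (x + 1) ^ (1 - β) / (x + 1) := by
      rw [← Real.rpow_sub_one hx1.ne']
      congr 1
      ring
    rw [h3]
    have h4 : (1 + (β - 1) / (x + 1)) * (x + 1) ^ (1 - β) =
      (x + 1) ^ (1 - β) + (x + 1) ^ (1 - β) / (x + 1) * (β - 1) := by ring
    linarith
  have hsum : ∑ i ∈ Finset.range m, ((n : ℝ) + (i + 1 : ℕ)) ^ (-β) ≤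
      ((n : ℝ) ^ (1 - β) - ((n : ℝ) + m) ^ (1 - β)) / (β - 1) := by
    induction m with
    | zero => simp
    | succ m ih =>
      rw [Finset.sum_range_succ]
      have h := hstep (n + m) (by positivity)
      push_cast at ih h ⊢
      rw [← add_assoc]
      refine (add_le_add ih h).trans (le_of_eq ?_)
      ring
  refine hsum.trans ?_
  have : 0 ≤ ((n : ℝ) + m) ^ (1 - β) := by positivity
  have hβ' : 0 < β - 1 := by linarith
  gcongr
  linarith

/-- Every infinite type with an `ℕ`-valued function has initial finite subsets of each size. -/
lemma exists_finset_card_eq_forall_le {ι : Type*} [Infinite ι] (q : ι → ℕ) (n : ℕ) :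
    ∃ Λ : Finset ι, Λ.card = n ∧ ∀ l ∈ Λ, ∀ k ∉ Λ, q l ≤ q k := by
  classical
  induction n with
  | zero => exact ⟨∅, by simp⟩
  | succ n ih =>
    obtain ⟨Λ, hcard, hΛ⟩ := ih
    obtain ⟨x, hx, hmin⟩ : ∃ x ∈ ((Λ : Set ι)ᶜ), ∀ k ∈ ((Λ : Set ι)ᶜ), q x ≤ q k := by
      have hne : ((Λ : Set ι)ᶜ).Nonempty := Λ.finite_toSet.infinite_compl.nonempty
      exact ⟨Function.argminOn q _ hne, Function.argminOn_mem _ _ _,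
        fun k hk => Function.argminOn_le q _ hk⟩
    have hx' : x ∉ Λ := by simpa using hx
    refine ⟨insert x Λ, by rw [Finset.card_insert_of_notMem hx', hcard], fun l hl k hk => ?_⟩
    rw [Finset.mem_insert, not_or] at hk
    rcases Finset.mem_insert.1 hl with rfl | hl
    · exact hmin k (by simpa using hk.2)
    · exact hΛ l hl k hk.2

/-- Summation of a decreasing bound along the elements of a finite set outside an initial set. -/
lemma sum_le_sum_range_of_initial {ι : Type*} (q : ι → ℕ) (g : ι → ℝ) (φ : ℕ → ℝ)
    (Λ : Finset ι) (hΛ : ∀ l ∈ Λ, ∀ k ∉ Λ, q l ≤ q k)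
    (hg : ∀ (A : Finset ι) (k : ι), Λ.card ≤ A.card → (∀ l ∈ A, q l ≤ q k) → g k ≤ φ A.card)
    (S : Finset ι) (hS : Disjoint Λ S) :
    ∑ k ∈ S, g k ≤ ∑ i ∈ Finset.range S.card, φ (Λ.card + (i + 1)) := by
  classical
  induction S using Finset.induction_on_max_value q with
  | empty => simp
  | insert a S ha hmax ih =>
    rw [Finset.disjoint_insert_right] at hS
    rw [Finset.sum_insert ha, Finset.card_insert_of_notMem ha, Finset.sum_range_succ, add_comm]
    have hdisj : Disjoint Λ (insert a S) := by
      rw [Finset.disjoint_insert_right]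
      exact hS
    have hcard : (Λ ∪ insert a S).card = Λ.card + (S.card + 1) := by
      rw [Finset.card_union_of_disjoint hdisj, Finset.card_insert_of_notMem ha]
    refine add_le_add (ih hS.2) ?_
    rw [← hcard]
    refine hg _ _ (by omega) fun l hl => ?_
    rcases Finset.mem_union.1 hl with hl | hl
    · exact hΛ l hl a hS.1
    · rcases Finset.mem_insert.1 hl with rfl | hl
      · exact le_rfl
      · exact hmax l hl

lemma wIso_two_eq (d : ℕ) (s : ℝ) (k : ZLat d) :
    wIso d s 2 k = (1 + ∑ j, (k j : ℝ) ^ 2) ^ (s / 2) := by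
  simp [wIso]

lemma wIso_pos (d : ℕ) (s r : ℝ) (k : ZLat d) : 0 < wIso d s r k := by
  unfold wIso
  have : 0 ≤ ∑ j, |(k j : ℝ)| ^ r := Finset.sum_nonneg fun j _ => by positivity
  positivity

/-- The weight at the outermost point of a large set of lattice points. -/
lemma inv_wIso_two_le {d : ℕ} (hd : 0 < d) {s : ℝ} (hs : 0 < s) (A : Finset (ZLat d)) (k : ZLat d)
    (hA : ∀ l ∈ A, ∑ j, (l j : ℝ) ^ 2 ≤ ∑ j, (k j : ℝ) ^ 2)
    (hlarge : (9 : ℝ) ^ d * Real.exp ((d : ℝ) / 2) ≤ A.card) :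
    (wIso d s 2 k)⁻¹ ≤ (32 * Real.exp 1 / d) ^ (s / 2) * (A.card : ℝ) ^ (-(s / d)) := by
  have hd' : (0 : ℝ) < d := by exact_mod_cast hd
  have hpos : (0 : ℝ) < A.card := lt_of_lt_of_le (by positivity) hlarge
  have h := card_le_of_large hd A (Q := 1 + ∑ j, (k j : ℝ) ^ 2)
    (fun l hl => by linarith [hA l hl]) hlarge
  have hQ : 0 < 1 + ∑ j, (k j : ℝ) ^ 2 := by
    have : 0 ≤ ∑ j, (k j : ℝ) ^ 2 := Finset.sum_nonneg fun j _ => sq_nonneg _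
    linarith
  have h2 := Real.rpow_le_rpow hpos.le h (by positivity : 0 ≤ s / d)
  have h3 : (d : ℝ) / 2 * (s / d) = s / 2 := by field_simp
  rw [← Real.rpow_mul (by positivity), h3, Real.mul_rpow (by positivity) hQ.le,
    ← wIso_two_eq] at h2
  rw [Real.rpow_neg hpos.le, ← div_eq_mul_inv, inv_eq_one_div,
    div_le_div_iff₀ (wIso_pos _ _ _ _) (by positivity), one_mul]
  exact h2

/-- Tails of the inverse weights, summed off a suitable set of `n` lattice points. -/
lemma exists_sum_inv_wIso_rpow_le {d : ℕ} (hd : 0 < d) {s r : ℝ} (hs : 0 < s) (hr : 0 < r)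
    (hsr : 1 < s / d * r) {n : ℕ} (hn : (9 : ℝ) ^ d * Real.exp ((d : ℝ) / 2) ≤ n) :
    ∃ Λ : Finset (ZLat d), Λ.card = n ∧ ∀ S : Finset (ZLat d), Disjoint Λ S →
      ∑ k ∈ S, (wIso d s 2 k)⁻¹ ^ r ≤ ((32 * Real.exp 1 / d) ^ (s / 2)) ^ r *
        ((n : ℝ) ^ (1 - s / d * r) / (s / d * r - 1)) := by
  have hd' : (0 : ℝ) < d := by exact_mod_cast hd
  have : Nonempty (Fin d) := ⟨⟨0, hd⟩⟩
  have hn0 : (0 : ℝ) < n := lt_of_lt_of_le (by positivity) hn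
  set q : ZLat d → ℕ := fun k => ∑ j, (k j).natAbs ^ 2 with hq
  have hqcast : ∀ k, (q k : ℝ) = ∑ j, (k j : ℝ) ^ 2 := by
    intro k
    simp only [hq]
    push_cast
    refine Finset.sum_congr rfl fun j _ => ?_
    rw [Nat.cast_natAbs, Int.cast_abs, sq_abs]
  obtain ⟨Λ, hcard, hΛ⟩ := exists_finset_card_eq_forall_le q n
  refine ⟨Λ, hcard, fun S hS => ?_⟩
  set C : ℝ := (32 * Real.exp 1 / d) ^ (s / 2) with hC
  have hC0 : 0 ≤ C := by positivity
  have hmain := sum_le_sum_range_of_initial q (fun k => (wIso d s 2 k)⁻¹ ^ r)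
    (fun m => C ^ r * (m : ℝ) ^ (-(s / d * r))) Λ hΛ (by
      intro A k hA hle
      have hlarge : (n : ℝ) ≤ A.card := by
        rw [hcard] at hA
        exact_mod_cast hA
      have h := inv_wIso_two_le hd hs A k (fun l hl => by
        rw [← hqcast, ← hqcast]
        exact_mod_cast hle l hl) (hn.trans hlarge)
      have h2 := Real.rpow_le_rpow (inv_nonneg.2 (wIso_pos _ _ _ _).le) h hr.le
      rw [Real.mul_rpow hC0 (by positivity), ← Real.rpow_mul (Nat.cast_nonneg A.card), neg_mul] at h2
      exact h2) S hS
  refine hmain.trans ?_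
  rw [← Finset.mul_sum, hcard]
  have h := sum_range_rpow_neg_le (n := n) (by exact_mod_cast hn0) hsr S.card
  push_cast at h ⊢
  gcongr

/-- Complex powers of a bounded nonnegative function integrate to a holomorphic function of the
exponent on the right half plane. -/
lemma differentiableAt_integral_mul_cpow {X : Type*} [MeasurableSpace X] {μ : Measure X}
    [IsFiniteMeasure μ] {H : X → ℂ} {u : X → ℝ} {M L : ℝ} (hH : Measurable H)
    (hHL : ∀ x, ‖H x‖ ≤ L) (hu : Measurable u) (hu0 : ∀ x, 0 ≤ u x) (huM : ∀ x, u x ≤ M)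
    {w₀ : ℂ} (hw₀ : 0 < w₀.re) :
    DifferentiableAt ℂ (fun w : ℂ => ∫ x, H x * (u x : ℂ) ^ w ∂μ) w₀ := by
  set c₀ : ℝ := w₀.re / 2 with hc₀
  set c₁ : ℝ := w₀.re + c₀ with hc₁
  have hc₀pos : 0 < c₀ := by positivity
  set M' : ℝ := max M 1 with hM'
  have hM1 : 1 ≤ M' := le_max_right _ _
  have hre : ∀ w ∈ Metric.ball w₀ c₀, c₀ < w.re ∧ w.re < c₁ := by
    intro w hw
    have h := (Complex.abs_re_le_norm (w - w₀)).trans_lt (by simpa [dist_eq_norm] using hw)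
    rw [Complex.sub_re, abs_lt] at h
    constructor <;> linarith [h.1, h.2]
  have hmeas : ∀ w : ℂ, Measurable fun x => H x * (u x : ℂ) ^ w := fun w => by fun_prop
  have hnorm : ∀ x, ∀ w : ℂ, 0 < w.re → ‖(u x : ℂ) ^ w‖ = u x ^ w.re := fun x w hw =>
    Complex.norm_cpow_eq_rpow_re_of_nonneg (hu0 x) hw.ne'
  have hL : ∀ x, 0 ≤ L := fun x => (norm_nonneg _).trans (hHL x)
  have hpow : ∀ x, ∀ w ∈ Metric.ball w₀ c₀, u x ^ w.re ≤ M' ^ c₁ := by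
    intro x w hw
    calc u x ^ w.re ≤ M' ^ w.re := by
          have := (hre w hw).1
          exact Real.rpow_le_rpow (hu0 x) ((huM x).trans (le_max_left _ _)) (by linarith)
      _ ≤ M' ^ c₁ := Real.rpow_le_rpow_of_exponent_le hM1 (hre w hw).2.le
  have hbound : ∀ x, ∀ w ∈ Metric.ball w₀ c₀,
      ‖H x * ((u x : ℂ) ^ w * Complex.log (u x))‖ ≤ L * (1 / c₀ + M' ^ c₁ * M') := by
    intro x w hw
    have hwre : 0 < w.re := hc₀pos.trans (hre w hw).1
    rw [norm_mul]
    refine mul_le_mul (hHL x) ?_ (norm_nonneg _) (hL x)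
    rw [norm_mul, hnorm x w hwre, ← Complex.ofReal_log (hu0 x), Complex.norm_real, Real.norm_eq_abs]
    have hpos1 : 0 ≤ M' ^ c₁ * M' := by positivity
    rcases (hu0 x).eq_or_lt with h0 | h0
    · rw [← h0, Real.zero_rpow hwre.ne', zero_mul]
      positivity
    rcases le_total (u x) 1 with h1 | h1
    · have h := (Real.abs_log_mul_self_rpow_lt (u x) w.re h0 h1 hwre).le
      rw [abs_mul, abs_of_nonneg (Real.rpow_nonneg (hu0 x) _), mul_comm] at h
      have h2 : 1 / w.re ≤ 1 / c₀ := one_div_le_one_div_of_le hc₀pos (hre w hw).1.le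
      linarith
    · have hlog : |Real.log (u x)| ≤ M' := by
        rw [abs_of_nonneg (Real.log_nonneg h1)]
        have := Real.log_le_sub_one_of_pos h0
        have := (huM x).trans (le_max_left M 1)
        linarith
      have h2 : u x ^ w.re * |Real.log (u x)| ≤ M' ^ c₁ * M' :=
        mul_le_mul (hpow x w hw) hlog (abs_nonneg _) (by positivity)
      have : 0 ≤ 1 / c₀ := by positivity
      linarith
  have hball : Metric.ball w₀ c₀ ∈ nhds w₀ := Metric.ball_mem_nhds _ hc₀pos
  refine (hasDerivAt_integral_of_dominated_loc_of_deriv_le (μ := μ)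
    (F := fun w x => H x * (u x : ℂ) ^ w)
    (F' := fun w x => H x * ((u x : ℂ) ^ w * Complex.log (u x)))
    (bound := fun _ => L * (1 / c₀ + M' ^ c₁ * M')) hball
    (Filter.Eventually.of_forall fun w => (hmeas w).aestronglyMeasurable) ?_ ?_
    (Filter.Eventually.of_forall hbound) (integrable_const _) ?_).2.differentiableAt
  · refine Integrable.of_bound (hmeas w₀).aestronglyMeasurable (L * M' ^ c₁)
      (Filter.Eventually.of_forall fun x => ?_)
    rw [norm_mul, hnorm x w₀ hw₀]
    exact mul_le_mul (hHL x) (hpow x w₀ (mem_of_mem_nhds hball)) (Real.rpow_nonneg (hu0 x) _) (hL x)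
  · have : Measurable fun x => H x * ((u x : ℂ) ^ w₀ * Complex.log (u x)) := by fun_prop
    exact this.aestronglyMeasurable
  · refine Filter.Eventually.of_forall fun x w hw => ?_
    have hwre : 0 < w.re := hc₀pos.trans (hre w hw).1
    refine HasDerivAt.const_mul (H x) ?_
    by_cases h0 : (u x : ℂ) = 0
    · have hw0 : w ≠ 0 := fun h => by simp [h] at hwre
      have hev : (fun w : ℂ => (u x : ℂ) ^ w) =ᶠ[nhds w] fun _ => 0 := by
        filter_upwards [isOpen_ne.mem_nhds hw0] with v hv
        rw [h0, Complex.zero_cpow hv]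
      rw [h0, Complex.log_zero, mul_zero]
      rw [h0] at hev
      exact (hasDerivAt_const w (0 : ℂ)).congr_of_eventuallyEq hev
    · simpa using (hasDerivAt_id w).const_cpow (c := (u x : ℂ)) (Or.inl h0)

/-- An interpolated synthesis estimate: for an orthonormal system bounded by one, the diagonal
operator with entries `σ` followed by synthesis maps `ℓ²` to `L^p` with norm at most `‖σ‖_r`. -/
lemma rpow_integral_norm_sum_le {X ι : Type*} [MeasurableSpace X] {μ : Measure X}
    [IsProbabilityMeasure μ] (S : Finset ι) (e : ι → X → ℂ) (he : ∀ k, Measurable (e k))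
    (he1 : ∀ k x, ‖e k x‖ ≤ 1)
    (hbessel : ∀ c : ι → ℂ, ∫ x, ‖∑ k ∈ S, c k * e k x‖ ^ 2 ∂μ ≤ ∑ k ∈ S, ‖c k‖ ^ 2)
    (b : ι → ℂ) (σ : ι → ℝ) (hσ : ∀ k, 0 < σ k) {p r : ℝ} (hp : 2 < p)
    (hr : 1 / r = 1 / 2 - 1 / p) :
    (∫ x, ‖∑ k ∈ S, b k * σ k * e k x‖ ^ p ∂μ) ^ (1 / p) ≤
      (∑ k ∈ S, σ k ^ r) ^ (1 / r) * √(∑ k ∈ S, ‖b k‖ ^ 2) := by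
  have hp0 : 0 < p := by linarith
  have hr0 : 0 < r := by
    have h : 1 / p < 1 / 2 := one_div_lt_one_div_of_lt (by norm_num) hp
    exact one_div_pos.1 (by linarith)
  set f : X → ℂ := fun x => ∑ k ∈ S, b k * σ k * e k x with hf
  have hfm : Measurable f := Finset.measurable_fun_sum _ fun k _ => (he k).const_mul _
  set φ : ℂ → X → ℂ := fun z x => ∑ k ∈ S, (b k * (σ k : ℂ) ^ (z * (r / 2))) * e k x with hφ
  have hφm : ∀ z, Measurable (φ z) := fun z =>
    Finset.measurable_fun_sum _ fun k _ => (he k).const_mul _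
  set h : X → ℂ := fun x => starRingEnd ℂ (f x) / ‖f x‖ with hh
  have hhm : Measurable h :=
    (Complex.continuous_conj.measurable.comp hfm).div (Complex.measurable_ofReal.comp hfm.norm)
  have hh1 : ∀ x, ‖h x‖ ≤ 1 := fun x => by
    simp only [hh, norm_div, RCLike.norm_conj, Complex.norm_real, norm_norm]
    exact div_self_le_one _
  set M : ℝ := ∑ k ∈ S, ‖b k‖ * σ k with hM
  have hfM : ∀ x, ‖f x‖ ≤ M := fun x => by
    refine norm_sum_le_of_le _ fun k _ => ?_
    rw [norm_mul, norm_mul, Complex.norm_real, Real.norm_of_nonneg (hσ k).le]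
    exact mul_le_of_le_one_right (mul_nonneg (norm_nonneg _) (hσ k).le) (he1 k x)
  have hφ1 : ∀ z x, ‖φ z x‖ ≤ ∑ k ∈ S, ‖b k‖ * σ k ^ (z.re * (r / 2)) := fun z x => by
    refine norm_sum_le_of_le _ fun k _ => ?_
    have hre : (z * ((r : ℂ) / 2)).re = z.re * (r / 2) := by
      have : (r : ℂ) / 2 = ((r / 2 : ℝ) : ℂ) := by push_cast; rfl
      rw [this, Complex.re_mul_ofReal]
    rw [norm_mul, norm_mul, Complex.norm_cpow_eq_rpow_re_of_pos (hσ k), hre]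
    exact mul_le_of_le_one_right
      (mul_nonneg (norm_nonneg _) (Real.rpow_nonneg (hσ k).le _)) (he1 k x)
  set B : ℝ := ∫ x, ‖f x‖ ^ p ∂μ with hB
  have hB0 : 0 ≤ B := integral_nonneg fun x => by positivity
  set N : ℝ := √(∑ k ∈ S, ‖b k‖ ^ 2) with hN
  set A : ℝ := ∑ k ∈ S, σ k ^ r with hA
  have hA0 : 0 ≤ A := Finset.sum_nonneg fun k _ => Real.rpow_nonneg (hσ k).le _
  have hfint : ∀ q : ℝ, 0 ≤ q → Integrable (fun x => ‖f x‖ ^ q) μ := fun q hq => by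
    refine Integrable.of_bound (by fun_prop) (M ^ q) (Eventually.of_forall fun x => ?_)
    rw [Real.norm_of_nonneg (by positivity)]
    exact Real.rpow_le_rpow (norm_nonneg _) (hfM x) hq
  set F : ℂ → ℂ := fun z => ∫ x, φ z x * h x * (‖f x‖ : ℂ) ^ (p * (1 + z) / 2) ∂μ with hF
  have hre : ∀ z : ℂ, ((p : ℂ) * (1 + z) / 2).re = p * (1 + z.re) / 2 := fun z => by
    have : (p : ℂ) * (1 + z) / 2 = ((p / 2 : ℝ) : ℂ) * (1 + z) := by push_cast; ring
    rw [this, Complex.re_ofReal_mul]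
    simp only [Complex.add_re, Complex.one_re]
    ring
  have hcpow : ∀ z : ℂ, 0 ≤ z.re → ∀ x,
      ‖(‖f x‖ : ℂ) ^ (p * (1 + z) / 2)‖ = ‖f x‖ ^ (p * (1 + z.re) / 2) := fun z hz x => by
    rw [Complex.norm_cpow_eq_rpow_re_of_nonneg (norm_nonneg _), hre]
    rw [hre]
    positivity
  have hpt : ∀ z : ℂ, 0 ≤ z.re → ∀ x, ‖φ z x * h x * (‖f x‖ : ℂ) ^ (p * (1 + z) / 2)‖ ≤
      ‖φ z x‖ * ‖f x‖ ^ (p * (1 + z.re) / 2) := fun z hz x => by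
    rw [norm_mul, norm_mul, hcpow z hz]
    gcongr
    exact mul_le_of_le_one_right (norm_nonneg _) (hh1 x)
  have hdiff : DifferentiableOn ℂ F {z | 0 ≤ z.re} := by
    have hFsum : ∀ z ∈ {z : ℂ | 0 ≤ z.re}, F z = ∑ k ∈ S, (b k * (σ k : ℂ) ^ (z * (r / 2))) *
        ∫ x, e k x * h x * (‖f x‖ : ℂ) ^ (p * (1 + z) / 2) ∂μ := by
      intro z hz
      have hz' : 0 ≤ z.re := hz
      simp only [hF, hφ, ← integral_const_mul]
      rw [← integral_finsetSum]
      · refine integral_congr_ae (Eventually.of_forall fun x => ?_)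
        simp only [Finset.sum_mul]
        refine Finset.sum_congr rfl fun k _ => ?_
        ring
      · intro k _
        refine Integrable.const_mul ?_ _
        refine Integrable.mono' (hfint (p * (1 + z.re) / 2) (by positivity))
          (Measurable.aestronglyMeasurable (by have := he k; fun_prop))
          (Eventually.of_forall fun x => ?_)
        rw [norm_mul, norm_mul, hcpow z hz]
        exact mul_le_of_le_one_left (by positivity)
          (mul_le_one₀ (he1 k x) (norm_nonneg _) (hh1 x))
    refine DifferentiableOn.congr ?_ hFsum
    refine DifferentiableOn.fun_sum fun k _ => DifferentiableOn.mul ?_ ?_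
    · refine DifferentiableOn.const_mul (fun z _ => DifferentiableAt.differentiableWithinAt ?_) _
      refine DifferentiableAt.const_cpow (by fun_prop) (Or.inl ?_)
      exact_mod_cast (hσ k).ne'
    · intro z hz
      have hz' : 0 ≤ z.re := hz
      refine DifferentiableAt.differentiableWithinAt ?_
      refine DifferentiableAt.comp (𝕜 := ℂ)
        (g := fun w : ℂ => ∫ x, e k x * h x * (‖f x‖ : ℂ) ^ w ∂μ)
        (f := fun z : ℂ => (p : ℂ) * (1 + z) / 2) z ?_ (by fun_prop)
      refine differentiableAt_integral_mul_cpow (L := 1) ((he k).mul hhm) (fun x => ?_) hfm.norm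
        (fun x => norm_nonneg _) hfM ?_
      · rw [Pi.mul_apply, norm_mul]
        exact mul_le_one₀ (he1 k x) (norm_nonneg _) (hh1 x)
      · rw [hre]
        positivity
  have hclosed : IsClosed (Complex.HadamardThreeLines.verticalClosedStrip 0 1) :=
    isClosed_Icc.preimage Complex.continuous_re
  have hcl : closure (Complex.HadamardThreeLines.verticalStrip 0 1) ⊆
      Complex.HadamardThreeLines.verticalClosedStrip 0 1 :=
    closure_minimal (Set.preimage_mono Set.Ioo_subset_Icc_self) hclosed
  have hdc : DiffContOnCl ℂ F (Complex.HadamardThreeLines.verticalStrip 0 1) :=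
    (hdiff.mono (hcl.trans fun z hz => hz.1)).diffContOnCl
  have hbdd : BddAbove ((norm ∘ F) '' Complex.HadamardThreeLines.verticalClosedStrip 0 1) := by
    refine ⟨(∑ k ∈ S, ‖b k‖ * (max (σ k) 1) ^ (r / 2)) * (max M 1) ^ p, ?_⟩
    rintro _ ⟨z, ⟨hz0, hz1⟩, rfl⟩
    have hmain := norm_integral_le_of_norm_le_const (μ := μ)
      (f := fun x => φ z x * h x * (‖f x‖ : ℂ) ^ (p * (1 + z) / 2))
      (C := (∑ k ∈ S, ‖b k‖ * (max (σ k) 1) ^ (r / 2)) * (max M 1) ^ p)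
      (Eventually.of_forall fun x => ?_)
    · simpa using hmain
    · refine (hpt z hz0 x).trans (mul_le_mul ((hφ1 z x).trans ?_) ?_ (by positivity) ?_)
      · refine Finset.sum_le_sum fun k _ => mul_le_mul_of_nonneg_left ?_ (norm_nonneg _)
        calc σ k ^ (z.re * (r / 2)) ≤ (max (σ k) 1) ^ (z.re * (r / 2)) :=
              Real.rpow_le_rpow (hσ k).le (le_max_left _ _) (mul_nonneg hz0 (by positivity))
          _ ≤ _ := Real.rpow_le_rpow_of_exponent_le (le_max_right _ _)
              (mul_le_of_le_one_left (by positivity) hz1)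
      · have hz0' : 0 ≤ z.re := hz0
        have hz1' : z.re ≤ 1 := hz1
        calc ‖f x‖ ^ (p * (1 + z.re) / 2) ≤ (max M 1) ^ (p * (1 + z.re) / 2) :=
              Real.rpow_le_rpow (norm_nonneg _) ((hfM x).trans (le_max_left _ _)) (by positivity)
          _ ≤ _ := Real.rpow_le_rpow_of_exponent_le (le_max_right _ _) (by nlinarith)
      · exact Finset.sum_nonneg fun k _ => by positivity
  have hφint : ∀ z : ℂ, ∀ q : ℝ, 0 ≤ q → Integrable (fun x => ‖φ z x‖ * ‖f x‖ ^ q) μ :=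
    fun z q hq => by
      refine ((hfint q hq).const_mul (∑ k ∈ S, ‖b k‖ * σ k ^ (z.re * (r / 2)))).mono'
        (Measurable.aestronglyMeasurable (by have := hφm z; fun_prop))
        (Eventually.of_forall fun x => ?_)
      rw [Real.norm_of_nonneg (by positivity)]
      exact mul_le_mul_of_nonneg_right (hφ1 z x) (by positivity)
  have hleft : ∀ z ∈ Complex.re ⁻¹' {(0 : ℝ)}, ‖F z‖ ≤ N * √B := by
    intro z hz
    have hz0 : z.re = 0 := hz
    have h1 : ‖F z‖ ≤ ∫ x, ‖φ z x‖ * ‖f x‖ ^ (p / 2) ∂μ := by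
      refine norm_integral_le_of_norm_le (hφint z _ (by positivity)) (Eventually.of_forall fun x => ?_)
      have := hpt z hz0.ge x
      rwa [hz0, add_zero, mul_one] at this
    have hMp : ∀ z, MemLp (fun x => ‖φ z x‖) (ENNReal.ofReal 2) μ := fun z =>
      MemLp.of_bound (hφm z).norm.aestronglyMeasurable _
        (Eventually.of_forall fun x => by simpa using hφ1 z x)
    have hMf : MemLp (fun x => ‖f x‖ ^ (p / 2)) (ENNReal.ofReal 2) μ :=
      MemLp.of_bound (Measurable.aestronglyMeasurable (by fun_prop)) (M ^ (p / 2))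
        (Eventually.of_forall fun x => by
          rw [Real.norm_of_nonneg (by positivity)]
          exact Real.rpow_le_rpow (norm_nonneg _) (hfM x) (by positivity))
    have h2 := integral_mul_le_Lp_mul_Lq_of_nonneg (μ := μ) Real.HolderConjugate.two_two
      (Eventually.of_forall fun x => norm_nonneg (φ z x))
      (Eventually.of_forall fun x => by positivity) (hMp z) hMf
    refine h1.trans (h2.trans ?_)
    rw [← Real.sqrt_eq_rpow, ← Real.sqrt_eq_rpow]
    refine mul_le_mul (Real.sqrt_le_sqrt ?_) (le_of_eq ?_) (Real.sqrt_nonneg _) (Real.sqrt_nonneg _)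
    · simp only [Real.rpow_two]
      refine (hbessel fun k => b k * (σ k : ℂ) ^ (z * (r / 2))).trans (le_of_eq ?_)
      refine Finset.sum_congr rfl fun k _ => ?_
      have hre0 : (z * ((r : ℂ) / 2)).re = 0 := by
        have : (r : ℂ) / 2 = ((r / 2 : ℝ) : ℂ) := by push_cast; rfl
        rw [this, Complex.re_mul_ofReal, hz0, zero_mul]
      rw [norm_mul, Complex.norm_cpow_eq_rpow_re_of_pos (hσ k), hre0, Real.rpow_zero, mul_one]
    · congr 1
      refine integral_congr_ae (Eventually.of_forall fun x => ?_)
      simp only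
      rw [← Real.rpow_mul (norm_nonneg _)]
      congr 1
      ring
  have hright : ∀ z ∈ Complex.re ⁻¹' {(1 : ℝ)}, ‖F z‖ ≤ N * √A * B := by
    intro z hz
    have hz1 : z.re = 1 := hz
    have hsup : ∀ x, ‖φ z x‖ ≤ N * √A := fun x => by
      refine (hφ1 z x).trans ((Real.sum_mul_le_sqrt_mul_sqrt _ _ _).trans (le_of_eq ?_))
      congr 2
      refine Finset.sum_congr rfl fun k _ => ?_
      rw [← Real.rpow_natCast, ← Real.rpow_mul (hσ k).le, hz1]
      congr 1
      push_cast
      ring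
    rw [hB, ← integral_const_mul]
    refine norm_integral_le_of_norm_le ((hfint p hp0.le).const_mul _) (Eventually.of_forall fun x => ?_)
    have h1 := hpt z (by rw [hz1]; exact zero_le_one) x
    have h2 : p * (1 + z.re) / 2 = p := by rw [hz1]; ring
    rw [h2] at h1
    exact h1.trans (mul_le_mul_of_nonneg_right (hsup x) (by positivity))
  set θ : ℝ := 1 - 2 / p with hθ
  have hθ0 : 0 < θ := by
    have : 2 / p < 1 := (div_lt_one hp0).2 hp
    linarith
  have hθ1 : θ ≤ 1 := by
    have : 0 < 2 / p := by positivity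
    linarith
  have hθr : θ = 2 / r := by
    have : 2 / r = 2 * (1 / r) := by ring
    rw [this, hr, hθ]
    ring
  have hval : F θ = (B : ℂ) := by
    rw [hB, ← integral_complex_ofReal]
    refine integral_congr_ae (Eventually.of_forall fun x => ?_)
    have hφθ : φ θ x = f x := by
      refine Finset.sum_congr rfl fun k _ => ?_
      have : (θ : ℂ) * (r / 2) = 1 := by
        rw [hθr]
        push_cast
        have : (r : ℂ) ≠ 0 := by exact_mod_cast hr0.ne'
        field_simp
      rw [this, Complex.cpow_one]
    have hexp : (p : ℂ) * (1 + θ) / 2 = ((p - 1 : ℝ) : ℂ) := by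
      rw [hθ]
      push_cast
      have : (p : ℂ) ≠ 0 := by exact_mod_cast hp0.ne'
      field_simp
      ring
    simp only [hφθ, hexp, hh]
    rw [← Complex.ofReal_cpow (norm_nonneg _), ← mul_div_assoc, Complex.mul_conj,
      Complex.normSq_eq_norm_sq]
    norm_cast
    rcases (norm_nonneg (f x)).eq_or_lt with h0 | h0
    · rw [← h0, Real.zero_rpow hp0.ne']
      simp
    · rw [Real.rpow_sub_one h0.ne']
      field_simp
  have hthree := Complex.HadamardThreeLines.norm_le_interp_of_mem_verticalClosedStrip₀₁' F
    (z := (θ : ℂ)) ⟨by simpa using hθ0.le, by simpa using hθ1⟩ hdc hbdd hleft hright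
  rw [hval, Complex.norm_real, Real.norm_of_nonneg hB0, Complex.ofReal_re] at hthree
  have hN0 : 0 ≤ N := Real.sqrt_nonneg _
  have hcombine : (N * √B) ^ (1 - θ) * (N * √A * B) ^ θ = N * A ^ (1 / r) * B ^ (1 - 1 / p) := by
    have e1 : N ^ (1 - θ) * N ^ θ = N := by
      rw [← Real.rpow_add' hN0 (by simp)]
      simp
    have e2 : (√A) ^ θ = A ^ (1 / r) := by
      rw [Real.sqrt_eq_rpow, ← Real.rpow_mul hA0, hθr]
      congr 1
      ring
    have e3 : (√B) ^ (1 - θ) * B ^ θ = B ^ (1 - 1 / p) := by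
      have hexp : 1 / 2 * (1 - θ) + θ = 1 - 1 / p := by rw [hθ]; ring
      have hpos : 1 - 1 / p ≠ 0 := by
        have : 1 / p < 1 := (div_lt_one hp0).2 (by linarith)
        linarith
      rw [Real.sqrt_eq_rpow, ← Real.rpow_mul hB0, ← Real.rpow_add' hB0 (by rwa [hexp]), hexp]
    rw [Real.mul_rpow hN0 (Real.sqrt_nonneg _), Real.mul_rpow (by positivity) hB0,
      Real.mul_rpow hN0 (Real.sqrt_nonneg _), e2]
    calc _ = (N ^ (1 - θ) * N ^ θ) * A ^ (1 / r) * ((√B) ^ (1 - θ) * B ^ θ) := by ring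
      _ = _ := by rw [e1, e3]
  rw [hcombine] at hthree
  rcases hB0.eq_or_lt with h0 | h0
  · rw [← h0, Real.zero_rpow (by positivity)]
    positivity
  · have hsplit : B = B ^ (1 / p) * B ^ (1 - 1 / p) := by
      rw [← Real.rpow_add h0]
      simp
    have hpos : 0 < B ^ (1 - 1 / p) := Real.rpow_pos_of_pos h0 _
    have : B ^ (1 / p) * B ^ (1 - 1 / p) ≤ N * A ^ (1 / r) * B ^ (1 - 1 / p) := by
      rwa [← hsplit]
    rw [mul_comm (A ^ (1 / r))]
    exact le_of_mul_le_mul_right this hpos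

lemma torusMeasure_eq_pi (d : ℕ) :
    torusMeasure d = Measure.pi fun _ => AddCircle.haarAddCircle := by
  refine (Measure.pi_eq fun s _ => ?_).symm
  rw [torusMeasure, Measure.smul_apply, Measure.pi_pi]
  simp only [AddCircle.volume_eq_smul_haarAddCircle, Measure.smul_apply, smul_eq_mul,
    Finset.prod_mul_distrib, Finset.prod_const, Finset.card_univ, Fintype.card_fin]
  rw [← mul_assoc, ← mul_pow, ENNReal.inv_mul_cancel _ ENNReal.ofReal_ne_top, one_pow, one_mul]
  exact (ENNReal.ofReal_pos.2 fact_two_pi_pos.out).ne'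

instance isProbabilityMeasure_torusMeasure (d : ℕ) : IsProbabilityMeasure (torusMeasure d) := by
  rw [torusMeasure_eq_pi]
  infer_instance

lemma continuous_torusChar {d : ℕ} (k : ZLat d) : Continuous (torusChar k) := by
  unfold torusChar
  fun_prop

lemma norm_torusChar {d : ℕ} (k : ZLat d) (x : Torus d) : ‖torusChar k x‖ = 1 := by
  rw [torusChar, norm_prod]
  exact Finset.prod_eq_one fun j _ => by rw [fourier_apply, Circle.norm_coe]

lemma conj_torusChar {d : ℕ} (k : ZLat d) (x : Torus d) :
    starRingEnd ℂ (torusChar k x) = torusChar (-k) x := by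
  simp [torusChar]

lemma torusChar_mul {d : ℕ} (k l : ZLat d) (x : Torus d) :
    torusChar k x * torusChar l x = torusChar (k + l) x := by
  simp [torusChar, Finset.prod_mul_distrib]

lemma integral_torusChar {d : ℕ} (k : ZLat d) :
    ∫ x, torusChar k x ∂(torusMeasure d) = if k = 0 then 1 else 0 := by
  have hone : ∀ m : ℤ, ∫ x : AddCircle (2 * Real.pi), fourier m x ∂AddCircle.haarAddCircle =
      if m = 0 then (1 : ℂ) else 0 := by
    intro m
    split_ifs with hm
    · simp [hm]
    · exact integral_eq_zero_of_add_right_eq_neg (fourier_add_half_inv_index hm fact_two_pi_pos.out)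
  rw [torusMeasure_eq_pi]
  simp only [torusChar]
  rw [integral_fintype_prod_eq_prod (fun j => fun y : AddCircle (2 * Real.pi) => fourier (k j) y)]
  simp only [hone]
  split_ifs with hk
  · simp [hk]
  · obtain ⟨j, hj⟩ := Function.ne_iff.1 hk
    exact Finset.prod_eq_zero (Finset.mem_univ j) (if_neg hj)

lemma integral_conj_torusChar_mul {d : ℕ} (k l : ZLat d) :
    ∫ x, starRingEnd ℂ (torusChar k x) * torusChar l x ∂(torusMeasure d) =
      if k = l then 1 else 0 := by
  simp only [conj_torusChar, torusChar_mul, integral_torusChar, neg_add_eq_zero]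

/-- Parseval's identity for trigonometric polynomials on the torus. -/
lemma integral_norm_sum_torusChar_sq {d : ℕ} (S : Finset (ZLat d)) (c : ZLat d → ℂ) :
    ∫ x, ‖∑ k ∈ S, c k * torusChar k x‖ ^ 2 ∂(torusMeasure d) = ∑ k ∈ S, ‖c k‖ ^ 2 := by
  classical
  have hcast : ((∫ x, ‖∑ k ∈ S, c k * torusChar k x‖ ^ 2 ∂(torusMeasure d) : ℝ) : ℂ) =
      ((∑ k ∈ S, ‖c k‖ ^ 2 : ℝ) : ℂ) := by
    rw [← integral_complex_ofReal]
    have hexpand : ∀ x : Torus d, ((‖∑ k ∈ S, c k * torusChar k x‖ ^ 2 : ℝ) : ℂ) =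
        ∑ k ∈ S, ∑ l ∈ S, starRingEnd ℂ (c k) * c l *
          (starRingEnd ℂ (torusChar k x) * torusChar l x) := by
      intro x
      push_cast
      rw [← Complex.conj_mul', map_sum, Finset.sum_mul_sum]
      refine Finset.sum_congr rfl fun k _ => Finset.sum_congr rfl fun l _ => ?_
      rw [map_mul]
      ring
    have hint : ∀ k l : ZLat d, Integrable (fun x => starRingEnd ℂ (c k) * c l *
        (starRingEnd ℂ (torusChar k x) * torusChar l x)) (torusMeasure d) := by
      intro k l
      refine Integrable.const_mul ?_ _
      refine Integrable.of_bound (Continuous.aestronglyMeasurable ?_) 1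
        (Eventually.of_forall fun x => ?_)
      · exact (Complex.continuous_conj.comp (continuous_torusChar k)).mul (continuous_torusChar l)
      · rw [norm_mul, RCLike.norm_conj, norm_torusChar, norm_torusChar, one_mul]
    simp_rw [hexpand]
    rw [integral_finsetSum _ fun k _ => integrable_finsetSum _ fun l _ => hint k l]
    push_cast
    refine Finset.sum_congr rfl fun k hk => ?_
    rw [integral_finsetSum _ fun l _ => hint k l]
    simp only [integral_const_mul, integral_conj_torusChar_mul, mul_ite, mul_one, mul_zero]
    rw [Finset.sum_ite_eq, if_pos hk, Complex.conj_mul']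
  exact_mod_cast hcast

/-- The characters of the torus as continuous functions. -/
def torusCharC {d : ℕ} (k : ZLat d) : C(Torus d, ℂ) := ⟨torusChar k, continuous_torusChar k⟩

/-- Trigonometric polynomials are uniformly dense in the continuous functions on the torus. -/
lemma span_torusCharC_closure_eq_top (d : ℕ) :
    (Submodule.span ℂ (Set.range (torusCharC (d := d)))).topologicalClosure = ⊤ := by
  classical
  let P : StarSubalgebra ℂ C(Torus d, ℂ) :=
    { toSubalgebra := Algebra.adjoin ℂ (Set.range torusCharC)
      star_mem' := by
        change Algebra.adjoin ℂ (Set.range torusCharC) ≤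
          star (Algebra.adjoin ℂ (Set.range torusCharC))
        refine Algebra.adjoin_le ?_
        rintro _ ⟨k, rfl⟩
        refine Algebra.subset_adjoin ⟨-k, ?_⟩
        ext x
        exact (conj_torusChar k x).symm }
  have hspan : Subalgebra.toSubmodule P.toSubalgebra =
      Submodule.span ℂ (Set.range (torusCharC (d := d))) := by
    apply Algebra.adjoin_eq_span_of_subset
    refine .trans (fun x => Submonoid.closure_induction (fun _ => id) ⟨0, ?_⟩ ?_)
      Submodule.subset_span
    · ext x
      simp [torusCharC, torusChar]
    · rintro _ _ _ _ ⟨k, rfl⟩ ⟨l, rfl⟩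
      refine ⟨k + l, ?_⟩
      ext x
      exact (torusChar_mul k l x).symm
  have hsep : P.SeparatesPoints := by
    intro x y hxy
    obtain ⟨i, hi⟩ := Function.ne_iff.1 hxy
    have hsingle : ∀ z : Torus d, torusChar (Pi.single i 1) z = fourier 1 (z i) := by
      intro z
      rw [torusChar, Finset.prod_eq_single i]
      · simp
      · intro j _ hj
        simp [Pi.single_eq_of_ne hj]
      · simp
    refine ⟨_, ⟨torusCharC (Pi.single i 1), Algebra.subset_adjoin ⟨_, rfl⟩, rfl⟩, ?_⟩
    change torusChar _ x ≠ torusChar _ y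
    rw [hsingle, hsingle, fourier_one, fourier_one]
    exact fun h => hi (AddCircle.injective_toCircle fact_two_pi_pos.out.ne' (Circle.coe_injective h))
  rw [← hspan]
  exact congr_arg (Subalgebra.toSubmodule <| StarSubalgebra.toSubalgebra ·)
    (ContinuousMap.starSubalgebra_topologicalClosure_eq_top_of_separatesPoints P hsep)

/-- A square-integrable function all of whose Fourier coefficients vanish is zero. -/
lemma ae_eq_zero_of_fourierCoef_eq_zero {d : ℕ} {f : Torus d → ℂ}
    (hf : MemLp f 2 (torusMeasure d)) (h : ∀ k, fourierCoef f k = 0) :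
    f =ᵐ[torusMeasure d] 0 := by
  set ι := ContinuousMap.toLp (E := ℂ) 2 (torusMeasure d) ℂ with hι
  set V := Submodule.span ℂ (Set.range fun k : ZLat d => ι (torusCharC k)) with hV
  have hdense : V.topologicalClosure = ⊤ := by
    have hmap := (ContinuousMap.toLp_denseRange (μ := torusMeasure d) ℂ (p := 2) (E := ℂ)
      (by norm_num)).topologicalClosure_map_submodule (span_torusCharC_closure_eq_top d)
    rw [Submodule.map_span, ← Set.range_comp] at hmap
    exact hmap
  have horth : ∀ v ∈ V, inner ℂ v (hf.toLp f) = 0 := by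
    intro v hv
    induction hv using Submodule.span_induction with
    | mem v hv =>
      obtain ⟨k, rfl⟩ := hv
      rw [L2.inner_def, ← h k, fourierCoef]
      refine integral_congr_ae ?_
      filter_upwards [hf.coeFn_toLp, ContinuousMap.coeFn_toLp (p := 2) (𝕜 := ℂ) (torusMeasure d)
        (torusCharC k)] with x h1 h2
      rw [h1, h2, RCLike.inner_apply, mul_comm]
      rfl
    | zero => simp
    | add v w _ _ hv hw => rw [inner_add_left, hv, hw, add_zero]
    | smul a v _ hv => rw [inner_smul_left, hv, mul_zero]
  have hzero : hf.toLp f = 0 := by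
    have hdense' : Dense (V : Set (Lp ℂ 2 (torusMeasure d))) :=
      Submodule.dense_iff_topologicalClosure_eq_top.2 hdense
    exact hdense'.eq_zero_of_mem_orthogonal (𝕜 := ℂ)
      ((Submodule.mem_orthogonal _ _).2 horth)
  exact (hf.coeFn_toLp.symm.trans (by rw [hzero]; exact Lp.coeFn_zero _ _ _))

section Embedding

variable {d : ℕ} {p : ℝ≥0∞} [Fact (1 ≤ p)] {s : ℝ}
  {T : ellTwo d →L[ℂ] Lp ℂ p (torusMeasure d)}

/-- The embedding sends unit vectors to weighted characters. -/
lemma coeFn_embedding_single (hp2 : 2 ≤ p)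
    (hT : ∀ (c : ellTwo d) (k : ZLat d), fourierCoef (⇑(T c)) k = c k / (wIso d s 2 k : ℂ))
    (k : ZLat d) (a : ℂ) :
    ⇑(T (lp.single 2 k a)) =ᵐ[torusMeasure d]
      fun x => a * ((wIso d s 2 k)⁻¹ : ℝ) * torusChar k x := by
  classical
  set g : Torus d → ℂ := fun x => a * ((wIso d s 2 k)⁻¹ : ℝ) * torusChar k x with hg
  have hgc : Continuous g := continuous_const.mul (continuous_torusChar k)
  have hg2 : MemLp g 2 (torusMeasure d) :=
    MemLp.of_bound hgc.aestronglyMeasurable ‖a * ((wIso d s 2 k)⁻¹ : ℝ)‖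
      (Eventually.of_forall fun x => by rw [hg, norm_mul, norm_torusChar, mul_one])
  have hf2 : MemLp (⇑(T (lp.single 2 k a))) 2 (torusMeasure d) :=
    (Lp.memLp _).mono_exponent hp2
  have hint : ∀ (f : Torus d → ℂ), MemLp f 2 (torusMeasure d) → ∀ l : ZLat d,
      Integrable (fun x => starRingEnd ℂ (torusChar l x) * f x) (torusMeasure d) := by
    intro f hf l
    refine (hf.integrable (by norm_num)).bdd_mul (c := 1)
      (Complex.continuous_conj.comp (continuous_torusChar l)).aestronglyMeasurable
      (Eventually.of_forall fun x => ?_)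
    simp [norm_torusChar]
  have hzero : ∀ l, fourierCoef (⇑(T (lp.single 2 k a)) - g) l = 0 := by
    intro l
    have hgl : fourierCoef g l = if l = k then a * ((wIso d s 2 k)⁻¹ : ℝ) else 0 := by
      have : ∀ x, starRingEnd ℂ (torusChar l x) * g x = a * ((wIso d s 2 k)⁻¹ : ℝ) *
          (starRingEnd ℂ (torusChar l x) * torusChar k x) := fun x => by
        simp only [hg]
        ring
      simp only [fourierCoef, this, integral_const_mul, integral_conj_torusChar_mul, mul_ite,
        mul_one, mul_zero]
    have hsub : fourierCoef (⇑(T (lp.single 2 k a)) - g) l =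
        fourierCoef (⇑(T (lp.single 2 k a))) l - fourierCoef g l := by
      simp only [fourierCoef, Pi.sub_apply, mul_sub]
      exact integral_sub (hint _ hf2 l) (hint _ hg2 l)
    rw [hsub, hT, hgl, lp.single_apply]
    split_ifs with hlk
    · subst hlk
      rw [Pi.single_eq_same]
      push_cast
      ring
    · rw [Pi.single_eq_of_ne hlk]
      simp
  have h := ae_eq_zero_of_fourierCoef_eq_zero (hf2.sub hg2) hzero
  filter_upwards [h] with x hx
  exact sub_eq_zero.1 hx

/-- Norm estimate for the embedding on finitely supported sequences. -/
lemma norm_sum_embedding_single_le (hp2 : 2 < p) (hpt : p ≠ ⊤) {r : ℝ}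
    (hr : 1 / r = 1 / 2 - 1 / p.toReal)
    (hT : ∀ (c : ellTwo d) (k : ZLat d), fourierCoef (⇑(T c)) k = c k / (wIso d s 2 k : ℂ))
    (S : Finset (ZLat d)) (c : ellTwo d) :
    ‖∑ k ∈ S, T (lp.single 2 k (c k))‖ ≤
      (∑ k ∈ S, (wIso d s 2 k)⁻¹ ^ r) ^ (1 / r) * ‖c‖ := by
  classical
  have hp2' : 2 < p.toReal := by
    rw [← ENNReal.toReal_ofNat]
    exact (ENNReal.toReal_lt_toReal (by norm_num) hpt).2 hp2
  set f : Torus d → ℂ := fun x => ∑ k ∈ S, c k * ((wIso d s 2 k)⁻¹ : ℝ) * torusChar k x with hf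
  have hae : ⇑(∑ k ∈ S, T (lp.single 2 k (c k))) =ᵐ[torusMeasure d] f := by
    simp only [hf]
    clear hf f
    induction S using Finset.induction_on with
    | empty =>
      simp only [Finset.sum_empty]
      exact Lp.coeFn_zero _ _ _
    | insert k S hk ih =>
      rw [Finset.sum_insert hk]
      filter_upwards [Lp.coeFn_add (T (lp.single 2 k (c k))) (∑ k ∈ S, T (lp.single 2 k (c k))),
        ih, coeFn_embedding_single hp2.le hT k (c k)] with x h1 h2 h3
      rw [h1, Pi.add_apply, h2, h3, Finset.sum_insert hk]
  have hmem : MemLp f p (torusMeasure d) := (memLp_congr_ae hae).1 (Lp.memLp _)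
  rw [Lp.norm_def, eLpNorm_congr_ae hae, hmem.eLpNorm_eq_integral_rpow_norm
    (by intro h; simp [h] at hp2) hpt, ENNReal.toReal_ofReal (by positivity), ← one_div]
  refine (rpow_integral_norm_sum_le S torusChar (fun k => (continuous_torusChar k).measurable)
    (fun k x => (norm_torusChar k x).le) (fun b => (integral_norm_sum_torusChar_sq S b).le) (⇑c)
    (fun k => (wIso d s 2 k)⁻¹) (fun k => inv_pos.2 (wIso_pos _ _ _ _)) hp2' hr).trans ?_
  refine mul_le_mul_of_nonneg_left ?_ (Real.rpow_nonneg (Finset.sum_nonneg fun k _ =>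
    Real.rpow_nonneg (inv_nonneg.2 (wIso_pos _ _ _ _).le) _) _)
  refine Real.sqrt_le_iff.2 ⟨norm_nonneg _, ?_⟩
  simpa using lp.sum_rpow_le_norm_rpow (by norm_num) c S

/-- Truncating the embedding to a finite set of frequencies bounds its approximation numbers. -/
lemma approxNum_embedding_le (hp2 : 2 < p) (hpt : p ≠ ⊤) {r : ℝ} (hr0 : 0 < r)
    (hr : 1 / r = 1 / 2 - 1 / p.toReal)
    (hT : ∀ (c : ellTwo d) (k : ZLat d), fourierCoef (⇑(T c)) k = c k / (wIso d s 2 k : ℂ))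
    (Λ : Finset (ZLat d)) {D : ℝ}
    (hD : ∀ S : Finset (ZLat d), Disjoint Λ S → ∑ k ∈ S, (wIso d s 2 k)⁻¹ ^ r ≤ D) :
    approxNum T (Λ.card + 1) ≤ D ^ (1 / r) := by
  classical
  have hD0 : 0 ≤ D := by simpa using hD ∅ (Finset.disjoint_empty_right _)
  set A : ellTwo d →L[ℂ] Lp ℂ p (torusMeasure d) := T.comp (∑ k ∈ Λ,
    (lp.singleContinuousLinearMap ℂ (fun _ : ZLat d => ℂ) 2 k).comp
      (lp.evalCLM ℂ (fun _ : ZLat d => ℂ) 2 k)) with hA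
  have hAc : ∀ c, A c = ∑ k ∈ Λ, T (lp.single 2 k (c k)) := by
    intro c
    simp only [hA, ContinuousLinearMap.comp_apply, _root_.sum_apply, map_sum]
    rfl
  have hrank : Module.rank ℂ (LinearMap.range (A : ellTwo d →ₗ[ℂ] Lp ℂ p (torusMeasure d))) <
      ((Λ.card + 1 : ℕ) : Cardinal) := by
    set G := Λ.image fun k => T (lp.single 2 k 1)
    have hle : LinearMap.range (A : ellTwo d →ₗ[ℂ] Lp ℂ p (torusMeasure d)) ≤
        Submodule.span ℂ (G : Set (Lp ℂ p (torusMeasure d))) := by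
      rintro _ ⟨c, rfl⟩
      rw [ContinuousLinearMap.coe_coe, hAc]
      refine Submodule.sum_mem _ fun k hk => ?_
      have h1 : lp.single (E := fun _ : ZLat d => ℂ) 2 k (c k) = c k • lp.single 2 k (1 : ℂ) := by
        rw [← lp.single_smul, smul_eq_mul, mul_one]
      rw [h1, map_smul]
      exact Submodule.smul_mem _ _ (Submodule.subset_span (by
        exact_mod_cast Finset.mem_image_of_mem _ hk))
    refine (Submodule.rank_mono hle).trans_lt ((rank_span_finset_le G).trans_lt ?_)
    exact_mod_cast Nat.lt_succ_of_le Finset.card_image_le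
  have hnorm : ‖T - A‖ ≤ D ^ (1 / r) := by
    refine ContinuousLinearMap.opNorm_le_bound _ (by positivity) fun c => ?_
    have hlim : Tendsto (fun S : Finset (ZLat d) => ∑ k ∈ S, T (lp.single 2 k (c k)) - A c)
        atTop (nhds ((T - A) c)) := by
      have h := (lp.hasSum_single (p := 2) (by norm_num) c).mapL T
      exact Tendsto.sub_const h (A c)
    refine le_of_tendsto hlim.norm ?_
    filter_upwards [eventually_ge_atTop Λ] with S hS
    rw [hAc, ← Finset.sum_sdiff hS, add_sub_cancel_right]
    refine (norm_sum_embedding_single_le hp2 hpt hr hT (S \ Λ) c).trans ?_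
    refine mul_le_mul_of_nonneg_right (Real.rpow_le_rpow (Finset.sum_nonneg fun k _ =>
      Real.rpow_nonneg (inv_nonneg.2 (wIso_pos _ _ _ _).le) _)
      (hD _ Finset.disjoint_sdiff) (by positivity)) (norm_nonneg _)
  unfold approxNum
  refine le_trans (csInf_le ⟨0, ?_⟩ ⟨A, hrank, rfl⟩) hnorm
  rintro _ ⟨B, -, rfl⟩
  exact norm_nonneg _

end Embedding

/-- Corollary 12b of Cobos–Kühn–Sickel. Let `2 < p < ∞`, define `r`
by `1/r = 1/2 - 1/p`, set `α = s/d`, and assume `s > d(1/2 - 1/p)` (i.e. `αr > 1`).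
Then for all `n ≥ 9^d e^{d/2}`,
`a_{n+1}(I_d : H^{s,2}(𝕋^d) → L_p(𝕋^d)) ≤ (αr-1)^{-1/r} (32e/d)^{s/2}
  n^{1/2 - 1/p - s/d}`. -/
theorem statement19 (d : ℕ) (hd : 0 < d) (p : ℝ≥0∞) [Fact (1 ≤ p)]
    (hp2 : 2 < p) (hpt : p ≠ ⊤) (r : ℝ) (hr : 1 / r = 1 / 2 - 1 / p.toReal)
    (s : ℝ) (hs : (d : ℝ) * (1 / 2 - 1 / p.toReal) < s)
    (T : ellTwo d →L[ℂ] Lp ℂ p (torusMeasure d))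
    (hT : ∀ (c : ellTwo d) (k : ZLat d), fourierCoef (⇑(T c)) k = c k / (wIso d s 2 k : ℂ)) :
    ∀ n : ℕ, (9 : ℝ) ^ d * Real.exp ((d : ℝ) / 2) ≤ (n : ℝ) →
      approxNum T (n + 1) ≤
        (s / (d : ℝ) * r - 1) ^ (-(1 / r)) * (32 * Real.exp 1 / (d : ℝ)) ^ (s / 2) *
          (n : ℝ) ^ ((1 : ℝ) / 2 - 1 / p.toReal - s / (d : ℝ)) := by
  intro n hn
  have hd' : (0 : ℝ) < d := by exact_mod_cast hd
  have hn0 : (0 : ℝ) < n := lt_of_lt_of_le (by positivity) hn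
  have hp2' : 2 < p.toReal := by
    rw [← ENNReal.toReal_ofNat]
    exact (ENNReal.toReal_lt_toReal (by norm_num) hpt).2 hp2
  have hr0 : 0 < r := by
    have h : 1 / p.toReal < 1 / 2 := one_div_lt_one_div_of_lt (by norm_num) hp2'
    exact one_div_pos.1 (by linarith)
  rw [← hr] at hs ⊢
  have hs0 : 0 < s := lt_trans (by positivity) hs
  have hsr : 1 < s / d * r := by
    rw [mul_one_div, div_lt_iff₀ hr0] at hs
    rwa [div_mul_eq_mul_div, lt_div_iff₀ hd', one_mul]
  obtain ⟨Λ, hcard, hΛ⟩ := exists_sum_inv_wIso_rpow_le hd hs0 hr0 hsr hn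
  have hmain := approxNum_embedding_le hp2 hpt hr0 hr hT Λ hΛ
  rw [hcard] at hmain
  refine hmain.trans (le_of_eq ?_)
  have hβ : 0 < s / d * r - 1 := by linarith
  have hC : 0 ≤ (32 * Real.exp 1 / (d : ℝ)) ^ (s / 2) := by positivity
  rw [Real.mul_rpow (by positivity) (by positivity), ← Real.rpow_mul hC,
    mul_one_div_cancel hr0.ne', Real.rpow_one, Real.div_rpow (by positivity) hβ.le,
    ← Real.rpow_mul hn0.le, Real.rpow_neg hβ.le]
  have hexp : (1 - s / d * r) * (1 / r) = 1 / r - s / d := by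
    field_simp
  rw [hexp]
  ring
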